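/- For every n ≥ 1 and distinct atoms p, q, there exists a valuation v ∈ F_{C_n} with v(p → (¬p → q)) = F_n; hence the explosion principle p → (¬p → q) is not a tautology of the RNmatrix R(M_{C_n}). -/

import Mathlib

/-- Formulas of the language of da Costa's calculi `Cₙ`. -/
inductive CnForm : Type where
  | atom : ℕ → CnForm
  | neg : CnForm → CnForm
  | conj : CnForm → CnForm → CnForm
  | disj : CnForm → CnForm → CnForm
  | imp : CnForm → CnForm → CnForm
deriving DecidableEq

/-- Truth values of the Nmatrix `M_{Cₙ}`: `Tv` is `Tₙ`, `tv i` is `tᵢⁿ`, `Fv` is `Fₙ`. -/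
inductive CnVal (n : ℕ) : Type where
  | Tv : CnVal n
  | tv : Fin n → CnVal n
  | Fv : CnVal n
deriving DecidableEq

/-- Multifunction for negation. -/
def CnNeg {n : ℕ} : CnVal n → Set (CnVal n)
  | CnVal.Tv => {CnVal.Fv}
  | CnVal.tv _ => {x | x ≠ CnVal.Fv}
  | CnVal.Fv => {CnVal.Tv}

/-- Multifunction for conjunction. -/
def CnConj {n : ℕ} (x y : CnVal n) : Set (CnVal n) :=
  if x = CnVal.Fv ∨ y = CnVal.Fv then {CnVal.Fv}
  else if x = CnVal.Tv ∧ y = CnVal.Tv then {CnVal.Tv}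
  else {z | z ≠ CnVal.Fv}

/-- Multifunction for disjunction. -/
def CnDisj {n : ℕ} (x y : CnVal n) : Set (CnVal n) :=
  if x = CnVal.Fv ∧ y = CnVal.Fv then {CnVal.Fv}
  else if (x = CnVal.Tv ∨ x = CnVal.Fv) ∧ (y = CnVal.Tv ∨ y = CnVal.Fv) ∧
          (x = CnVal.Tv ∨ y = CnVal.Tv) then {CnVal.Tv}
  else {z | z ≠ CnVal.Fv}

/-- Multifunction for implication. -/
def CnImp {n : ℕ} (x y : CnVal n) : Set (CnVal n) :=
  if x ≠ CnVal.Fv ∧ y = CnVal.Fv then {CnVal.Fv}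
  else if (x = CnVal.Fv ∧ (y = CnVal.Tv ∨ y = CnVal.Fv)) ∨ (x = CnVal.Tv ∧ y = CnVal.Tv)
    then {CnVal.Tv}
  else {z | z ≠ CnVal.Fv}

/-- `v ∈ Val(M_{Cₙ})`: `v` is a valuation of the Nmatrix `M_{Cₙ}`. -/
def CnIsVal {n : ℕ} (v : CnForm → CnVal n) : Prop :=
  (∀ a, v (CnForm.neg a) ∈ CnNeg (v a)) ∧
  (∀ a b, v (CnForm.conj a b) ∈ CnConj (v a) (v b)) ∧
  (∀ a b, v (CnForm.disj a b) ∈ CnDisj (v a) (v b)) ∧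
  (∀ a b, v (CnForm.imp a b) ∈ CnImp (v a) (v b))

/-- `a.pow k` is `αᵏ`: `α⁰ = α`, `α^{k+1} = ¬(αᵏ ∧ ¬αᵏ)`. -/
def CnForm.pow (a : CnForm) : ℕ → CnForm
  | 0 => a
  | k + 1 => CnForm.neg (CnForm.conj (a.pow k) (CnForm.neg (a.pow k)))

/-- `v ∈ F_{Cₙ}`: a valuation satisfying the restriction of the RNmatrix for `Cₙ`. -/
def CnRestricted {n : ℕ} (v : CnForm → CnVal n) : Prop :=
  CnIsVal v ∧
  ∀ (a : CnForm) (i : Fin n), v a = CnVal.tv i →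
    (i.val = 0 → v (CnForm.conj a (CnForm.neg a)) = CnVal.Tv) ∧
    (∀ j : Fin n, i.val = j.val + 1 →
      (∃ m : Fin n, v (CnForm.conj a (CnForm.neg a)) = CnVal.tv m) ∧
      v (a.pow 1) = CnVal.tv j)

/-- Tautology of the RNmatrix `R(M_{Cₙ}) = ⟨F_{Cₙ}, M_{Cₙ}⟩`. -/
def CnTaut (n : ℕ) (φ : CnForm) : Prop :=
  ∀ v : CnForm → CnVal n, CnRestricted v → v φ ≠ CnVal.Fv

/-- The valuation giving the atom `p` the value `t`, every other atom the value `Fₙ`, and every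
compound formula a classical value. -/
def CnForm.evalAt {n : ℕ} (p : ℕ) (t : CnVal n) : CnForm → CnVal n
  | .atom r => if r = p then t else .Fv
  | .neg a => if a.evalAt p t = .Tv then .Fv else .Tv
  | .conj a b => if a.evalAt p t = .Fv ∨ b.evalAt p t = .Fv then .Fv else .Tv
  | .disj a b => if a.evalAt p t = .Fv ∧ b.evalAt p t = .Fv then .Fv else .Tv
  | .imp a b => if a.evalAt p t ≠ .Fv ∧ b.evalAt p t = .Fv then .Fv else .Tv

theorem CnForm.evalAt_isVal {n : ℕ} (p : ℕ) (t : CnVal n) :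
    CnIsVal (CnForm.evalAt p t) := by
  refine ⟨fun a => ?_, fun a b => ?_, fun a b => ?_, fun a b => ?_⟩
  · simp only [CnForm.evalAt]
    cases a.evalAt p t <;> simp [CnNeg]
  · simp only [CnForm.evalAt, CnConj]
    split_ifs <;> simp_all
  · simp only [CnForm.evalAt, CnDisj]
    split_ifs <;> simp_all
  · simp only [CnForm.evalAt, CnImp]
    split_ifs <;> simp_all

theorem CnForm.evalAt_eq_tv {n : ℕ} {p : ℕ} {t : CnVal n} {a : CnForm} {i : Fin n}
    (h : a.evalAt p t = .tv i) : a = .atom p ∧ t = .tv i := by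
  cases a <;> simp only [CnForm.evalAt] at h <;> split_ifs at h
  simp_all

theorem CnForm.evalAt_restricted {n : ℕ} (p : ℕ) (k : Fin n) (hk : k.val = 0) :
    CnRestricted (CnForm.evalAt p (.tv k)) := by
  refine ⟨CnForm.evalAt_isVal p _, fun a i h => ?_⟩
  obtain ⟨rfl, ht⟩ := CnForm.evalAt_eq_tv h
  obtain rfl : k = i := by simpa using ht
  exact ⟨fun _ => by simp [CnForm.evalAt], fun j hj => by omega⟩

theorem explosion_not_a_tautology_of_Cn (n : ℕ) (hn : 1 ≤ n) (p q : ℕ) (hpq : p ≠ q) :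
    (∃ v : CnForm → CnVal n, CnRestricted v ∧
      v (CnForm.imp (CnForm.atom p)
        (CnForm.imp (CnForm.neg (CnForm.atom p)) (CnForm.atom q))) = CnVal.Fv) ∧
    ¬ CnTaut n (CnForm.imp (CnForm.atom p)
        (CnForm.imp (CnForm.neg (CnForm.atom p)) (CnForm.atom q))) := by
  have hv := CnForm.evalAt_restricted p (⟨0, hn⟩ : Fin n) rfl
  have hF : CnForm.evalAt p (CnVal.tv (⟨0, hn⟩ : Fin n)) (CnForm.imp (CnForm.atom p)
      (CnForm.imp (CnForm.neg (CnForm.atom p)) (CnForm.atom q))) = CnVal.Fv := by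
    simp [CnForm.evalAt, hpq.symm]
  exact ⟨⟨_, hv, hF⟩, fun h => h _ hv hF⟩
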